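/- Let bp(I) be the blueprint obtained from a failed run of Prove_C on input I, and let G be a C-saturated seq-tree of bp(I) with component (w, i). If the implication A ⊃ B belongs to the consequent of component (w,i) of G, then there exists a C-saturated seq-tree H of bp(I) with a component (u, j) such that there is a morphic sequence (w,i) ⟶_σ (u,j), A belongs to the antecedent of (u,j) in H, and B belongs to the consequent of (u,j) in H. -/

import Mathlib

/-! # Core definitions: intuitionistic tense logic, bi-relational semantics,
nested sequents (seq-trees), the calculus NIK_tC, proof search, computation
trees, morphisms and blueprints. -/

/-- Formulae of the tense language `𝓛`:
`A ::= p | ⊥ | A ∨ A | A ∧ A | A ⊃ A | ◇A | ◆A | □A | ■A`. -/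
inductive Fml : Type where
  | atom : ℕ → Fml
  | bot  : Fml
  | or   : Fml → Fml → Fml
  | and  : Fml → Fml → Fml
  | imp  : Fml → Fml → Fml
  | dia  : Fml → Fml   -- ◇ (forward diamond)
  | bdia : Fml → Fml   -- ◆ (backward diamond)
  | box  : Fml → Fml   -- □ (forward box)
  | bbox : Fml → Fml   -- ■ (backward box)
  deriving DecidableEq

namespace Fml

/-- Modal depth of a formula. -/
def mdep : Fml → ℕ
  | atom _ => 0
  | bot => 0
  | or A B => max A.mdep B.mdep
  | and A B => max A.mdep B.mdep
  | imp A B => max A.mdep B.mdep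
  | dia A => A.mdep + 1
  | bdia A => A.mdep + 1
  | box A => A.mdep + 1
  | bbox A => A.mdep + 1

/-- The set of subformulae of a formula. -/
def subf : Fml → Finset Fml
  | atom p => {atom p}
  | bot => {bot}
  | or A B => insert (or A B) (A.subf ∪ B.subf)
  | and A B => insert (and A B) (A.subf ∪ B.subf)
  | imp A B => insert (imp A B) (A.subf ∪ B.subf)
  | dia A => insert (dia A) A.subf
  | bdia A => insert (bdia A) A.subf
  | box A => insert (box A) A.subf
  | bbox A => insert (bbox A) A.subf

/-- `⟨x⟩`: the diamond determined by the direction `x` (`true` = forward `◇`,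
`false` = backward `◆`). -/
def diaF : Bool → Fml → Fml
  | true, A => dia A
  | false, A => bdia A

/-- `[x]`: the box determined by the direction `x` (`true` = forward `□`,
`false` = backward `■`). -/
def boxF : Bool → Fml → Fml
  | true, A => box A
  | false, A => bbox A

end Fml

/-- A bi-relational model `M = (W, ≤, R, V)`: `≤` is a pre-order, `R` satisfies
the confluence conditions (F1) and (F2), and `V` is monotone along `≤`. -/
structure Model where
  W : Type
  le : W → W → Prop
  R : W → W → Prop
  val : W → ℕ → Prop
  nonempty : Nonempty W
  le_refl : ∀ w, le w w
  le_trans : ∀ {w u v}, le w u → le u v → le w v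
  F1 : ∀ {w w' v}, le w w' → R w v → ∃ v', R w' v' ∧ le v v'
  F2 : ∀ {w v v'}, R w v → le v v' → ∃ w', le w w' ∧ R w' v'
  mono : ∀ {w u p}, le w u → val w p → val u p

/-- The satisfaction relation `M, w ⊨ A`. -/
def Model.Sat (M : Model) : M.W → Fml → Prop
  | w, .atom p => M.val w p
  | _, .bot => False
  | w, .or A B => M.Sat w A ∨ M.Sat w B
  | w, .and A B => M.Sat w A ∧ M.Sat w B
  | w, .imp A B => ∀ u, M.le w u → M.Sat u A → M.Sat u B
  | w, .dia A => ∃ u, M.R w u ∧ M.Sat u A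
  | w, .bdia A => ∃ u, M.R u w ∧ M.Sat u A
  | w, .box A => ∀ u v, M.le w u → M.R u v → M.Sat v A
  | w, .bbox A => ∀ u v, M.le w u → M.R v u → M.Sat v A

/-- `M` is based on a frame in the class `F_C`, where the subset
`C ⊆ {T, B, D}` is encoded by the three Boolean flags `ct`, `cb`, `cd`:
`R` is reflexive if `T ∈ C`, symmetric if `B ∈ C`, and serial if `D ∈ C`. -/
def Model.InClass (M : Model) (ct cb cd : Bool) : Prop :=
  (ct = true → ∀ w, M.R w w) ∧
  (cb = true → ∀ w u, M.R w u → M.R u w) ∧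
  (cd = true → ∀ w, ∃ u, M.R w u)

/-- A Gentzen sequent `Γ ⊢ Δ` (finite sets of formulae). -/
abbrev GSeq : Type := Finset Fml × Finset Fml

/-- A seq-tree (equivalently, a nested sequent): a finite rooted tree whose
vertices (names, drawn from `ℕ`) are labelled with Gentzen sequents and whose
edges are labelled with a direction (`true` = forward `•`, `false` =
backward `◦`). -/
structure SeqTree where
  verts : Finset ℕ
  root : ℕ
  edges : Finset (ℕ × ℕ)
  elabel : ℕ → ℕ → Bool
  vlab : ℕ → GSeq
  root_mem : root ∈ verts
  edges_sub : ∀ e ∈ edges, e.1 ∈ verts ∧ e.2 ∈ verts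
  root_no_parent : ∀ u, (u, root) ∉ edges
  parent_unique : ∀ v ∈ verts, ∀ u u', (u, v) ∈ edges → (u', v) ∈ edges → u = u'
  connected : ∀ v ∈ verts, Relation.ReflTransGen (fun a b => (a, b) ∈ edges) root v

namespace SeqTree

/-- The antecedent (input formulae) of the `w`-component. -/
def ant (T : SeqTree) (w : ℕ) : Finset Fml := (T.vlab w).1

/-- The consequent (output formulae) of the `w`-component. -/
def suc (T : SeqTree) (w : ℕ) : Finset Fml := (T.vlab w).2

/-- `T.AtDepth w k`: the component `w` occurs at depth `k` in `T`. -/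
inductive AtDepth (T : SeqTree) : ℕ → ℕ → Prop where
  | root : T.AtDepth T.root 0
  | step {u v k} : T.AtDepth u k → (u, v) ∈ T.edges → T.AtDepth v (k + 1)

/-- `w` is a leaf of the seq-tree `T`. -/
def IsLeaf (T : SeqTree) (w : ℕ) : Prop := w ∈ T.verts ∧ ∀ u, (w, u) ∉ T.edges

/-- The modal depth of a nested sequent: the maximum over components `w` at
depth `k` of `(modal depth of a formula at w) + k`. -/
noncomputable def mdep (T : SeqTree) : ℕ :=
  sSup {n | ∃ w ∈ T.verts, ∃ k, T.AtDepth w k ∧ ∃ A ∈ T.ant w ∪ T.suc w, n = A.mdep + k}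

/-- `T ⊨ w ↠ₓ^C u`: the C-closure reachability relation of Definition 3.3,
with `C ⊆ {T,B}` encoded by the flags `ct`, `cb`. -/
def Reach (T : SeqTree) (ct cb : Bool) (x : Bool) (w u : ℕ) : Prop :=
  ((w, u) ∈ T.edges ∧ T.elabel w u = x) ∨
  ((u, w) ∈ T.edges ∧ T.elabel u w = !x) ∨
  (ct = true ∧ w = u ∧ w ∈ T.verts) ∨
  (cb = true ∧ (((w, u) ∈ T.edges ∧ T.elabel w u = !x) ∨
                ((u, w) ∈ T.edges ∧ T.elabel u w = x)))

/-- All formulae occurring in `T`, together with their subformulae. -/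
def subfs (T : SeqTree) : Finset Fml :=
  (T.verts.biUnion fun w => T.ant w ∪ T.suc w).biUnion Fml.subf

end SeqTree

/-- `M, ι ⊨ T`: satisfaction of a seq-tree on a model under an
`M`-interpretation `ι` (Definition 3.2): if every `•`-edge `(u,v)` satisfies
`ι(u) R ι(v)` and every `◦`-edge `(u,v)` satisfies `ι(v) R ι(u)`, then some
component `v` satisfies `M, ι(v) ⊨ ⋀Γ ⊃ ⋁Δ`. -/
def Model.SatSeq (M : Model) (T : SeqTree) (ι : ℕ → M.W) : Prop :=
  (∀ e ∈ T.edges, (T.elabel e.1 e.2 = true → M.R (ι e.1) (ι e.2)) ∧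
                  (T.elabel e.1 e.2 = false → M.R (ι e.2) (ι e.1))) →
  ∃ v ∈ T.verts, ∀ u, M.le (ι v) u →
    (∀ A ∈ T.ant v, M.Sat u A) → ∃ B ∈ T.suc v, M.Sat u B

/-- A default (trivial) seq-tree. -/
def SeqTree.triv : SeqTree where
  verts := {0}
  root := 0
  edges := ∅
  elabel := fun _ _ => true
  vlab := fun _ => (∅, ∅)
  root_mem := Finset.mem_singleton_self 0
  edges_sub := by intro e he; simp at he
  root_no_parent := by intro u h; simp at h
  parent_unique := by intro v _ u u' h; simp at h
  connected := by
    intro v hv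
    have hv0 : v = 0 := Finset.mem_singleton.mp hv
    subst hv0
    exact Relation.ReflTransGen.refl

instance : Inhabited SeqTree := ⟨SeqTree.triv⟩

/-- The nested sequent `⊢ A` consisting of a single component with empty
antecedent and consequent `{A}`. -/
def singleSeq (A : Fml) : SeqTree where
  verts := {0}
  root := 0
  edges := ∅
  elabel := fun _ _ => true
  vlab := fun _ => (∅, {A})
  root_mem := Finset.mem_singleton_self 0
  edges_sub := by intro e he; simp at he
  root_no_parent := by intro u h; simp at h
  parent_unique := by intro v _ u u' h; simp at h
  connected := by
    intro v hv
    have hv0 : v = 0 := Finset.mem_singleton.mp hv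
    subst hv0
    exact Relation.ReflTransGen.refl

/-! ## Morphisms between seq-trees -/

/-- A weak morphism between seq-trees: a root-preserving vertex map that
preserves edges and edge labels. -/
def WeakMorphism (T T' : SeqTree) (f : ℕ → ℕ) : Prop :=
  (∀ v ∈ T.verts, f v ∈ T'.verts) ∧
  f T.root = T'.root ∧
  ∀ u v, (u, v) ∈ T.edges → (f u, f v) ∈ T'.edges ∧ T.elabel u v = T'.elabel (f u) (f v)

/-- A strong morphism: a weak morphism additionally preserving vertex labels. -/
def StrongMorphism (T T' : SeqTree) (f : ℕ → ℕ) : Prop :=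
  WeakMorphism T T' f ∧ ∀ v ∈ T.verts, T.vlab v = T'.vlab (f v)

/-- Morphic equivalence `T ≃ T'`: strong morphisms exist in both directions. -/
def MorphEquiv (T T' : SeqTree) : Prop :=
  (∃ f, StrongMorphism T T' f) ∧ (∃ g, StrongMorphism T' T g)

/-- `T ∈ S(I)`: all vertex labels of `T` are built from subformulae of `I`. -/
def InS (I T : SeqTree) : Prop := ∀ w ∈ T.verts, T.ant w ∪ T.suc w ⊆ I.subfs

/-- `T` has depth at most `k`. -/
def DepthLE (T : SeqTree) (k : ℕ) : Prop := ∀ v n, T.AtDepth v n → n ≤ k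

/-! ## The rules of the calculus `NIK_tC` -/

/-- Two seq-trees share the same underlying shape (vertices, root, edges,
edge labels). -/
def sameShape (T T' : SeqTree) : Prop :=
  T'.verts = T.verts ∧ T'.root = T.root ∧ T'.edges = T.edges ∧ T'.elabel = T.elabel

/-- `T'` is `T` with the label of the component `w` replaced by `s`. -/
def updAt (T : SeqTree) (w : ℕ) (s : GSeq) (T' : SeqTree) : Prop :=
  sameShape T T' ∧ T'.vlab = Function.update T.vlab w s

/-- `T'` is `T` extended with a fresh child `u` of `w`, over an edge labelled
`x`, with component label `s`. -/
def extendAt (T : SeqTree) (w u : ℕ) (x : Bool) (s : GSeq) (T' : SeqTree) : Prop :=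
  w ∈ T.verts ∧ u ∉ T.verts ∧
  T'.verts = insert u T.verts ∧ T'.root = T.root ∧
  T'.edges = insert (w, u) T.edges ∧
  T'.elabel = (fun a b => if a = w ∧ b = u then x else T.elabel a b) ∧
  T'.vlab = Function.update T.vlab u s

/-- The rule `∨L` (conclusion `T`, premises `T1`, `T2`). -/
def OrLRule (T : SeqTree) (w : ℕ) (A B : Fml) (T1 T2 : SeqTree) : Prop :=
  ∃ Γ, w ∈ T.verts ∧ T.ant w = insert (A.or B) Γ ∧
    updAt T w (insert A Γ, T.suc w) T1 ∧ updAt T w (insert B Γ, T.suc w) T2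

/-- The rule `∨R`. -/
def OrRRule (T : SeqTree) (w : ℕ) (A B : Fml) (T' : SeqTree) : Prop :=
  ∃ Δ, w ∈ T.verts ∧ T.suc w = insert (A.or B) Δ ∧
    updAt T w (T.ant w, insert A (insert B Δ)) T'

/-- The rule `∧L`. -/
def AndLRule (T : SeqTree) (w : ℕ) (A B : Fml) (T' : SeqTree) : Prop :=
  ∃ Γ, w ∈ T.verts ∧ T.ant w = insert (A.and B) Γ ∧
    updAt T w (insert A (insert B Γ), T.suc w) T'

/-- The rule `∧R`. -/
def AndRRule (T : SeqTree) (w : ℕ) (A B : Fml) (T1 T2 : SeqTree) : Prop :=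
  ∃ Δ, w ∈ T.verts ∧ T.suc w = insert (A.and B) Δ ∧
    updAt T w (T.ant w, insert A Δ) T1 ∧ updAt T w (T.ant w, insert B Δ) T2

/-- The rule `⊃L`. -/
def ImpLRule (T : SeqTree) (w : ℕ) (A B : Fml) (T1 T2 : SeqTree) : Prop :=
  ∃ Γ, w ∈ T.verts ∧ T.ant w = insert (A.imp B) Γ ∧
    updAt T w (T.ant w, insert A (T.suc w)) T1 ∧ updAt T w (insert B Γ, T.suc w) T2

/-- The (non-invertible) rule `⊃R`: all consequents of all other components are
deleted, and `A ⊢ B` is adjoined at `w`. -/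
def ImpRRule (T : SeqTree) (w : ℕ) (A B : Fml) (T' : SeqTree) : Prop :=
  w ∈ T.verts ∧ A.imp B ∈ T.suc w ∧ sameShape T T' ∧
  (∀ v, v ≠ w → T'.vlab v = (T.ant v, ∅)) ∧
  T'.vlab w = (insert A (T.ant w), {B})

/-- The rule `⟨x⟩L`: a fresh `x`-child containing `A` in its antecedent is
created. -/
def DiaLRule (T : SeqTree) (w u : ℕ) (x : Bool) (A : Fml) (T' : SeqTree) : Prop :=
  ∃ Γ, w ∈ T.verts ∧ u ∉ T.verts ∧ T.ant w = insert (Fml.diaF x A) Γ ∧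
    T'.verts = insert u T.verts ∧ T'.root = T.root ∧
    T'.edges = insert (w, u) T.edges ∧
    T'.elabel = (fun a b => if a = w ∧ b = u then x else T.elabel a b) ∧
    T'.vlab = fun v => if v = u then ({A}, ∅) else if v = w then (Γ, T.suc w) else T.vlab v

/-- The propagation rule `⟨x⟩R`, restricted by the C-closure reachability
relation `w ↠ₓ^C u`. -/
def DiaRRule (ct cb : Bool) (T : SeqTree) (w u : ℕ) (x : Bool) (A : Fml) (T' : SeqTree) : Prop :=
  w ∈ T.verts ∧ u ∈ T.verts ∧ Fml.diaF x A ∈ T.suc w ∧ T.Reach ct cb x w u ∧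
  updAt T u (T.ant u, insert A (T.suc u)) T'

/-- The propagation rule `[x]L`, restricted by `w ↠ₓ^C u`. -/
def BoxLRule (ct cb : Bool) (T : SeqTree) (w u : ℕ) (x : Bool) (A : Fml) (T' : SeqTree) : Prop :=
  w ∈ T.verts ∧ u ∈ T.verts ∧ Fml.boxF x A ∈ T.ant w ∧ T.Reach ct cb x w u ∧
  updAt T u (insert A (T.ant u), T.suc u) T'

/-- The (non-invertible) rule `[x]R`: all consequents are deleted and a fresh
`x`-child `⊢ A` is created. -/
def BoxRRule (T : SeqTree) (w u : ℕ) (x : Bool) (A : Fml) (T' : SeqTree) : Prop :=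
  w ∈ T.verts ∧ u ∉ T.verts ∧ Fml.boxF x A ∈ T.suc w ∧
  T'.verts = insert u T.verts ∧ T'.root = T.root ∧
  T'.edges = insert (w, u) T.edges ∧
  T'.elabel = (fun a b => if a = w ∧ b = u then x else T.elabel a b) ∧
  (∀ v ∈ T.verts, T'.vlab v = (T.ant v, ∅)) ∧
  T'.vlab u = (∅, {A})

/-- The rule `d`: an empty fresh `•`-child is adjoined. -/
def DRule (T : SeqTree) (w u : ℕ) (T' : SeqTree) : Prop :=
  extendAt T w u true (∅, ∅) T'

/-- Provability in the nested sequent calculus `NIK_tC`, where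
`C ⊆ {T, B, D}` is encoded by the Boolean flags `ct`, `cb`, `cd`
(the rule `d` belongs to the calculus iff `D ∈ C`). -/
inductive Prov (ct cb cd : Bool) : SeqTree → Prop where
  | id {T : SeqTree} {w p} : w ∈ T.verts → Fml.atom p ∈ T.ant w → Fml.atom p ∈ T.suc w →
      Prov ct cb cd T
  | botL {T : SeqTree} {w} : w ∈ T.verts → Fml.bot ∈ T.ant w → Prov ct cb cd T
  | orL {T w A B T1 T2} : OrLRule T w A B T1 T2 → Prov ct cb cd T1 → Prov ct cb cd T2 →
      Prov ct cb cd T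
  | orR {T w A B T'} : OrRRule T w A B T' → Prov ct cb cd T' → Prov ct cb cd T
  | andL {T w A B T'} : AndLRule T w A B T' → Prov ct cb cd T' → Prov ct cb cd T
  | andR {T w A B T1 T2} : AndRRule T w A B T1 T2 → Prov ct cb cd T1 → Prov ct cb cd T2 →
      Prov ct cb cd T
  | impL {T w A B T1 T2} : ImpLRule T w A B T1 T2 → Prov ct cb cd T1 → Prov ct cb cd T2 →
      Prov ct cb cd T
  | impR {T w A B T'} : ImpRRule T w A B T' → Prov ct cb cd T' → Prov ct cb cd T
  | diaL {T w u x A T'} : DiaLRule T w u x A T' → Prov ct cb cd T' → Prov ct cb cd T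
  | diaR {T w u x A T'} : DiaRRule ct cb T w u x A T' → Prov ct cb cd T' → Prov ct cb cd T
  | boxL {T w u x A T'} : BoxLRule ct cb T w u x A T' → Prov ct cb cd T' → Prov ct cb cd T
  | boxR {T w u x A T'} : BoxRRule T w u x A T' → Prov ct cb cd T' → Prov ct cb cd T
  | d {T w u T'} : cd = true → DRule T w u T' → Prov ct cb cd T' → Prov ct cb cd T

/-! ## Saturation, stability, initial sequents -/

/-- An initial sequent: some formula occurs among the input and output
formulae, or `⊥` occurs among the input formulae (lines 1–3 of `Prove_C`). -/
def InitialSeq (T : SeqTree) : Prop :=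
  (∃ A : Fml, (∃ w ∈ T.verts, A ∈ T.ant w) ∧ (∃ u ∈ T.verts, A ∈ T.suc u)) ∨
  (∃ w ∈ T.verts, Fml.bot ∈ T.ant w)

/-- `C`-saturation of a seq-tree (Definition 4.2); `m` is the modal depth of
the input sequent `I` of the proof search (used by condition `(d)`). -/
def Saturated (ct cb cd : Bool) (m : ℕ) (T : SeqTree) : Prop :=
  ∀ w ∈ T.verts,
    (∀ A : Fml, ¬ (A ∈ T.ant w ∧ A ∈ T.suc w)) ∧
    Fml.bot ∉ T.ant w ∧
    (∀ A B, A.or B ∈ T.ant w → A ∈ T.ant w ∨ B ∈ T.ant w) ∧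
    (∀ A B, A.or B ∈ T.suc w → A ∈ T.suc w ∧ B ∈ T.suc w) ∧
    (∀ A B, A.and B ∈ T.ant w → A ∈ T.ant w ∧ B ∈ T.ant w) ∧
    (∀ A B, A.and B ∈ T.suc w → A ∈ T.suc w ∨ B ∈ T.suc w) ∧
    (∀ A B, A.imp B ∈ T.ant w → A ∈ T.suc w ∨ B ∈ T.ant w) ∧
    (∀ x A, Fml.diaF x A ∈ T.ant w →
      ∃ u, (w, u) ∈ T.edges ∧ T.elabel w u = x ∧ A ∈ T.ant u) ∧
    (∀ x A u, Fml.diaF x A ∈ T.suc w → T.Reach ct cb x w u → A ∈ T.suc u) ∧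
    (∀ x A u, Fml.boxF x A ∈ T.ant w → T.Reach ct cb x w u → A ∈ T.ant u) ∧
    (cd = true → ∀ k, T.AtDepth w k → k ≤ m →
      ∃ u, (w, u) ∈ T.edges ∧ T.elabel w u = true)

/-- A stable seq-tree: saturated, with no output implications or boxes. -/
def StableSeq (ct cb cd : Bool) (m : ℕ) (T : SeqTree) : Prop :=
  Saturated ct cb cd m T ∧
  ∀ w ∈ T.verts, (∀ A B : Fml, A.imp B ∉ T.suc w) ∧
    (∀ A : Fml, Fml.box A ∉ T.suc w) ∧ (∀ A : Fml, Fml.bbox A ∉ T.suc w)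

/-- `T` is a repeat relative to the list `hist` of its ancestors: it is
saturated and admits a strong morphism to some ancestor (its companion). -/
def Repeats (ct cb cd : Bool) (m : ℕ) (hist : List SeqTree) (T : SeqTree) : Prop :=
  Saturated ct cb cd m T ∧ ∃ H ∈ hist, ∃ f, StrongMorphism T H f

/-- Proof search halts at `T` (relative to the ancestors `hist`): `T` is
initial, stable, or a repeat. -/
def Halted (ct cb cd : Bool) (m : ℕ) (hist : List SeqTree) (T : SeqTree) : Prop :=
  InitialSeq T ∨ StableSeq ct cb cd m T ∨ Repeats ct cb cd m hist T

/-! ## The proof-search steps of `Prove_C` -/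

/-- Adjoin `A` to the antecedent of the `w`-component (the operation
`G ◁_w (A ⊢)`). -/
def addAnt (T : SeqTree) (w : ℕ) (A : Fml) (T' : SeqTree) : Prop :=
  w ∈ T.verts ∧ updAt T w (insert A (T.ant w), T.suc w) T'

/-- Adjoin `A` to the consequent of the `w`-component (the operation
`G ◁_w (⊢ A)`). -/
def addSuc (T : SeqTree) (w : ℕ) (A : Fml) (T' : SeqTree) : Prop :=
  w ∈ T.verts ∧ updAt T w (T.ant w, insert A (T.suc w)) T'

/-- One (bottom-up, non-redundant) rule application performed by the
proof-search algorithm `Prove_C` on input of modal depth `m`, producing the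
premise `T'` from `T`.  The disjunctive-branching rule `db` (simultaneous
`⊃R`/`[x]R` applications) is applied only to saturated sequents. -/
def AlgStep (ct cb cd : Bool) (m : ℕ) (T T' : SeqTree) : Prop :=
  -- ∨L
  (∃ w A B, w ∈ T.verts ∧ Fml.or A B ∈ T.ant w ∧ A ∉ T.ant w ∧ B ∉ T.ant w ∧
    (addAnt T w A T' ∨ addAnt T w B T')) ∨
  -- ∨R
  (∃ w A B, w ∈ T.verts ∧ Fml.or A B ∈ T.suc w ∧ ¬ (A ∈ T.suc w ∧ B ∈ T.suc w) ∧
    updAt T w (T.ant w, insert A (insert B (T.suc w))) T') ∨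
  -- ∧L
  (∃ w A B, w ∈ T.verts ∧ Fml.and A B ∈ T.ant w ∧ ¬ (A ∈ T.ant w ∧ B ∈ T.ant w) ∧
    updAt T w (insert A (insert B (T.ant w)), T.suc w) T') ∨
  -- ∧R
  (∃ w A B, w ∈ T.verts ∧ Fml.and A B ∈ T.suc w ∧ A ∉ T.suc w ∧ B ∉ T.suc w ∧
    (addSuc T w A T' ∨ addSuc T w B T')) ∨
  -- ⊃L
  (∃ w A B, w ∈ T.verts ∧ Fml.imp A B ∈ T.ant w ∧ A ∉ T.suc w ∧ B ∉ T.ant w ∧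
    (addSuc T w A T' ∨ addAnt T w B T')) ∨
  -- ⟨x⟩L
  (∃ w u x A, w ∈ T.verts ∧ Fml.diaF x A ∈ T.ant w ∧
    (¬ ∃ v, T.Reach ct cb x w v ∧ A ∈ T.ant v) ∧
    extendAt T w u x ({A}, ∅) T') ∨
  -- ⟨x⟩R
  (∃ w u x A, w ∈ T.verts ∧ Fml.diaF x A ∈ T.suc w ∧ T.Reach ct cb x w u ∧
    A ∉ T.suc u ∧ addSuc T u A T') ∨
  -- [x]L
  (∃ w u x A, w ∈ T.verts ∧ Fml.boxF x A ∈ T.ant w ∧ T.Reach ct cb x w u ∧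
    A ∉ T.ant u ∧ addAnt T u A T') ∨
  -- d
  (cd = true ∧ ∃ w u k, T.AtDepth w k ∧ k ≤ m ∧
    (¬ ∃ v, (w, v) ∈ T.edges ∧ T.elabel w v = true) ∧ extendAt T w u true (∅, ∅) T') ∨
  -- db (simultaneous ⊃R / [x]R applications on saturated sequents)
  (Saturated ct cb cd m T ∧
    ((∃ w A B, ImpRRule T w A B T') ∨ (∃ w u x A, BoxRRule T w u x A T')))

/-- `T` occurs in the computation tree `ct(I)` generated by `Prove_C(I)`:
it is obtainable from `I` by a sequence of proof-search steps. -/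
def InCT (ct cb cd : Bool) (I T : SeqTree) : Prop :=
  Relation.ReflTransGen (AlgStep ct cb cd I.mdep) I T

/-! ## Computation trees -/

/-- A node of a computation tree: a seq-tree, the Boolean value returned by the
corresponding recursive call of `Prove_C`, and the list of child nodes. -/
inductive RTree : Type where
  | node : SeqTree → Bool → List RTree → RTree

/-- The seq-tree at the root of a computation tree. -/
def RTree.seq : RTree → SeqTree
  | .node T _ _ => T

/-- The Boolean label at the root of a computation tree. -/
def RTree.val : RTree → Bool
  | .node _ b _ => b

/-- The children of the root of a computation tree. -/
def RTree.kids : RTree → List RTree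
  | .node _ _ ts => ts

/-- Proof search is still running at `T` (none of the halting conditions of
lines 1–6 of `Prove_C` applies). -/
def Running (ct cb cd : Bool) (m : ℕ) (hist : List SeqTree) (T : SeqTree) : Prop :=
  ¬ InitialSeq T ∧ ¬ StableSeq ct cb cd m T ∧ ¬ Repeats ct cb cd m hist T

/-- `ValidCT ct cb cd m hist t`: the labelled tree `t` is a computation tree
generated by a run of `Prove_C` (with ancestor list `hist`): each parent is the
conclusion of a rule of `(NIK_tC ∖ {⊃R, [x]R}) ∪ {db}` with its children the
premises, halting nodes are labelled as the algorithm prescribes, conjunctive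
branching takes the conjunction of the children's values, and the disjunctive
branching rule `db` (applied to saturated sequents, with one premise for each
output implication and each output box) takes their disjunction. -/
inductive ValidCT (ct cb cd : Bool) (m : ℕ) : List SeqTree → RTree → Prop where
  | initial {hist T} : InitialSeq T → ValidCT ct cb cd m hist (.node T true [])
  | stable {hist T} : ¬ InitialSeq T → StableSeq ct cb cd m T →
      ValidCT ct cb cd m hist (.node T false [])
  | rep {hist T} : ¬ InitialSeq T → Repeats ct cb cd m hist T →
      ValidCT ct cb cd m hist (.node T false [])
  | orL {hist T w A B t1 t2} : Running ct cb cd m hist T →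
      w ∈ T.verts → Fml.or A B ∈ T.ant w → A ∉ T.ant w → B ∉ T.ant w →
      addAnt T w A t1.seq → addAnt T w B t2.seq →
      ValidCT ct cb cd m (T :: hist) t1 → ValidCT ct cb cd m (T :: hist) t2 →
      ValidCT ct cb cd m hist (.node T (t1.val && t2.val) [t1, t2])
  | orR {hist T w A B t} : Running ct cb cd m hist T →
      w ∈ T.verts → Fml.or A B ∈ T.suc w → ¬ (A ∈ T.suc w ∧ B ∈ T.suc w) →
      updAt T w (T.ant w, insert A (insert B (T.suc w))) t.seq →
      ValidCT ct cb cd m (T :: hist) t →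
      ValidCT ct cb cd m hist (.node T t.val [t])
  | andL {hist T w A B t} : Running ct cb cd m hist T →
      w ∈ T.verts → Fml.and A B ∈ T.ant w → ¬ (A ∈ T.ant w ∧ B ∈ T.ant w) →
      updAt T w (insert A (insert B (T.ant w)), T.suc w) t.seq →
      ValidCT ct cb cd m (T :: hist) t →
      ValidCT ct cb cd m hist (.node T t.val [t])
  | andR {hist T w A B t1 t2} : Running ct cb cd m hist T →
      w ∈ T.verts → Fml.and A B ∈ T.suc w → A ∉ T.suc w → B ∉ T.suc w →
      addSuc T w A t1.seq → addSuc T w B t2.seq →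
      ValidCT ct cb cd m (T :: hist) t1 → ValidCT ct cb cd m (T :: hist) t2 →
      ValidCT ct cb cd m hist (.node T (t1.val && t2.val) [t1, t2])
  | impL {hist T w A B t1 t2} : Running ct cb cd m hist T →
      w ∈ T.verts → Fml.imp A B ∈ T.ant w → A ∉ T.suc w → B ∉ T.ant w →
      addSuc T w A t1.seq → addAnt T w B t2.seq →
      ValidCT ct cb cd m (T :: hist) t1 → ValidCT ct cb cd m (T :: hist) t2 →
      ValidCT ct cb cd m hist (.node T (t1.val && t2.val) [t1, t2])
  | diaL {hist T w u x A t} : Running ct cb cd m hist T →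
      w ∈ T.verts → Fml.diaF x A ∈ T.ant w →
      (¬ ∃ v, T.Reach ct cb x w v ∧ A ∈ T.ant v) →
      extendAt T w u x ({A}, ∅) t.seq →
      ValidCT ct cb cd m (T :: hist) t →
      ValidCT ct cb cd m hist (.node T t.val [t])
  | diaR {hist T w u x A t} : Running ct cb cd m hist T →
      w ∈ T.verts → Fml.diaF x A ∈ T.suc w → T.Reach ct cb x w u → A ∉ T.suc u →
      addSuc T u A t.seq →
      ValidCT ct cb cd m (T :: hist) t →
      ValidCT ct cb cd m hist (.node T t.val [t])
  | boxL {hist T w u x A t} : Running ct cb cd m hist T →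
      w ∈ T.verts → Fml.boxF x A ∈ T.ant w → T.Reach ct cb x w u → A ∉ T.ant u →
      addAnt T u A t.seq →
      ValidCT ct cb cd m (T :: hist) t →
      ValidCT ct cb cd m hist (.node T t.val [t])
  | d {hist T w u k t} : Running ct cb cd m hist T →
      cd = true → T.AtDepth w k → k ≤ m →
      (¬ ∃ v, (w, v) ∈ T.edges ∧ T.elabel w v = true) →
      extendAt T w u true (∅, ∅) t.seq →
      ValidCT ct cb cd m (T :: hist) t →
      ValidCT ct cb cd m hist (.node T t.val [t])
  | db {hist T ts} : Running ct cb cd m hist T →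
      Saturated ct cb cd m T →
      (∀ t ∈ ts, ValidCT ct cb cd m (T :: hist) t) →
      (∀ t ∈ ts, (∃ w A B, ImpRRule T w A B t.seq) ∨ (∃ w u x A, BoxRRule T w u x A t.seq)) →
      (∀ w ∈ T.verts, ∀ A B, Fml.imp A B ∈ T.suc w → ∃ t ∈ ts, ImpRRule T w A B t.seq) →
      (∀ w ∈ T.verts, ∀ x A, Fml.boxF x A ∈ T.suc w → ∃ t ∈ ts, ∃ u, BoxRRule T w u x A t.seq) →
      ValidCT ct cb cd m hist (.node T (ts.any RTree.val) ts)

/-! ## Blueprints and the extracted counter-model -/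

/-- The subtree of a computation tree at the address `π` (a list of child
positions); addresses play the role of the positions of the enumeration `η`. -/
def RTree.at? : RTree → List ℕ → Option RTree
  | t, [] => some t
  | t, i :: π =>
    match t.kids[i]? with
    | some t' => t'.at? π
    | none => none

/-- The seq-tree at the address `π` of a computation tree. -/
def RTree.seqAt (t : RTree) (π : List ℕ) : SeqTree :=
  (t.at? π).elim default RTree.seq

/-- The node at address `π` exists and every node on the path from the root to
it (inclusive) is labelled `F`; these are the nodes of the blueprint `bp(I)`. -/
def FNode (t : RTree) (π : List ℕ) : Prop :=
  ∀ σ, σ <+: π → ∃ s, t.at? σ = some s ∧ s.val = false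

/-- Membership in the set `S` of the blueprint: an `F`-reachable node whose
seq-tree is `C`-saturated (an η-renamed saturated seq-tree of `bp(I)`;
the vertex `w` of the seq-tree at address `π` represents the renamed
component `(w, π)`). -/
def InSsat (ct cb cd : Bool) (m : ℕ) (t : RTree) (π : List ℕ) : Prop :=
  FNode t π ∧ Saturated ct cb cd m (t.seqAt π)

/-- The node at address `π` is a repeat of the blueprint: an `F`-path leaf of
the computation tree that is saturated but not stable. -/
def RepNode (ct cb cd : Bool) (m : ℕ) (t : RTree) (π : List ℕ) : Prop :=
  FNode t π ∧ (∃ s, t.at? π = some s ∧ s.kids = []) ∧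
  Saturated ct cb cd m (t.seqAt π) ∧ ¬ StableSeq ct cb cd m (t.seqAt π)

/-- `(gc, gf)` is a family `γ⃗` of strong morphisms mapping each repeat of the
blueprint to its companion: a proper ancestor belonging to `S` (C-saturated,
on an `F`-path) together with a strong morphism onto it. -/
def GammaOK (ct cb cd : Bool) (m : ℕ) (t : RTree)
    (gc : List ℕ → List ℕ) (gf : List ℕ → ℕ → ℕ) : Prop :=
  ∀ π, RepNode ct cb cd m t π →
    gc π <+: π ∧ gc π ≠ π ∧ InSsat ct cb cd m t (gc π) ∧
    StrongMorphism (t.seqAt π) (t.seqAt (gc π)) (gf π)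

/-- One step of a morphic sequence: either a natural morphism between members
of `S` related by `≺_bp*` (mapping `(w, π)` to `(w, π')`), or a strong morphism
of the family `γ⃗` mapping a repeat to its companion. -/
inductive MStep (ct cb cd : Bool) (m : ℕ) (t : RTree)
    (gc : List ℕ → List ℕ) (gf : List ℕ → ℕ → ℕ) :
    (ℕ × List ℕ) → (ℕ × List ℕ) → Prop where
  | nat {w : ℕ} {π π' : List ℕ} :
      InSsat ct cb cd m t π → InSsat ct cb cd m t π' → π <+: π' →
      w ∈ (t.seqAt π).verts →
      MStep ct cb cd m t gc gf (w, π) (w, π')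
  | rep {w : ℕ} {π : List ℕ} :
      RepNode ct cb cd m t π → w ∈ (t.seqAt π).verts →
      MStep ct cb cd m t gc gf (w, π) (gf π w, gc π)

/-- A morphic sequence `(w, π) ⟶_σ (u, π')` in the blueprint. -/
def MSeq (ct cb cd : Bool) (m : ℕ) (t : RTree)
    (gc : List ℕ → List ℕ) (gf : List ℕ → ℕ → ℕ) :
    (ℕ × List ℕ) → (ℕ × List ℕ) → Prop :=
  Relation.ReflTransGen (MStep ct cb cd m t gc gf)

/-- The set `W` of worlds of the extracted model: the (renamed) components of
the saturated seq-trees of the blueprint. -/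
def Worlds (ct cb cd : Bool) (m : ℕ) (t : RTree) : Set (ℕ × List ℕ) :=
  {a | InSsat ct cb cd m t a.2 ∧ a.1 ∈ (t.seqAt a.2).verts}

/-- The modal relation `R` of the extracted model: induced by the C-closure
reachability relation inside each saturated seq-tree, together with self-loops
at components of depth `m + 1` when `D ∈ C`. -/
def bpR (ct cb cd : Bool) (m : ℕ) (t : RTree) :
    (ℕ × List ℕ) → (ℕ × List ℕ) → Prop :=
  fun a b =>
    (a.2 = b.2 ∧ InSsat ct cb cd m t a.2 ∧ (t.seqAt a.2).Reach ct cb true a.1 b.1) ∨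
    (cd = true ∧ a = b ∧ InSsat ct cb cd m t a.2 ∧ (t.seqAt a.2).AtDepth a.1 (m + 1))

/-- The valuation `V` of the extracted model: `(w, π) ∈ V(p)` iff `p` occurs in
the antecedent of the component `(w, π)`. -/
def bpVal (ct cb cd : Bool) (m : ℕ) (t : RTree) : (ℕ × List ℕ) → ℕ → Prop :=
  fun a p => InSsat ct cb cd m t a.2 ∧ Fml.atom p ∈ (t.seqAt a.2).ant a.1

/-- Satisfaction over raw frame data (the same clauses as `Model.Sat`). -/
def SatR {W : Type} (le R : W → W → Prop) (val : W → ℕ → Prop) : W → Fml → Prop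
  | w, .atom p => val w p
  | _, .bot => False
  | w, .or A B => SatR le R val w A ∨ SatR le R val w B
  | w, .and A B => SatR le R val w A ∧ SatR le R val w B
  | w, .imp A B => ∀ u, le w u → SatR le R val u A → SatR le R val u B
  | w, .dia A => ∃ u, R w u ∧ SatR le R val u A
  | w, .bdia A => ∃ u, R u w ∧ SatR le R val u A
  | w, .box A => ∀ u v, le w u → R u v → SatR le R val v A
  | w, .bbox A => ∀ u v, le w u → R v u → SatR le R val v A

/-! ## Addresses in computation trees -/

theorem RTree.at?_cons {t t' : RTree} {i : ℕ} (h : t.kids[i]? = some t') (σ : List ℕ) :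
    t.at? (i :: σ) = t'.at? σ := by
  simp [RTree.at?, h]

theorem RTree.exists_kid_of_at?_cons {t s : RTree} {i : ℕ} {σ : List ℕ}
    (h : t.at? (i :: σ) = some s) : ∃ t', t.kids[i]? = some t' ∧ t'.at? σ = some s := by
  cases hk : t.kids[i]? with
  | none => simp [RTree.at?, hk] at h
  | some t' => exact ⟨t', rfl, by rwa [RTree.at?_cons hk] at h⟩

theorem RTree.at?_append {t s : RTree} {π : List ℕ} (h : t.at? π = some s) (σ : List ℕ) :
    t.at? (π ++ σ) = s.at? σ := by
  induction π generalizing t with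
  | nil =>
    obtain rfl : t = s := by simpa [RTree.at?] using h
    rfl
  | cons i π ih =>
    obtain ⟨t', hk, h'⟩ := RTree.exists_kid_of_at?_cons h
    rw [List.cons_append, RTree.at?_cons hk, ih h']

theorem RTree.seqAt_of_at? {t s : RTree} {π : List ℕ} (h : t.at? π = some s) :
    t.seqAt π = s.seq := by
  simp [RTree.seqAt, h]

theorem RTree.seqAt_append {t s : RTree} {π : List ℕ} (h : t.at? π = some s) (σ : List ℕ) :
    t.seqAt (π ++ σ) = s.seqAt σ := by
  simp [RTree.seqAt, RTree.at?_append h]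

theorem FNode.exists_at? {t : RTree} {π : List ℕ} (h : FNode t π) :
    ∃ s, t.at? π = some s ∧ s.val = false :=
  h π (List.prefix_refl π)

theorem fnode_nil {t : RTree} (h : t.val = false) : FNode t [] := by
  intro σ hσ
  rw [List.prefix_nil] at hσ
  exact ⟨t, by simp [hσ, RTree.at?], h⟩

theorem FNode.append {t s : RTree} {π σ : List ℕ} (hπ : FNode t π) (hs : t.at? π = some s)
    (hσ : FNode s σ) : FNode t (π ++ σ) := by
  intro ρ hρ
  rcases List.prefix_or_prefix_of_prefix hρ (List.prefix_append π σ) with h | ⟨ρ', rfl⟩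
  · exact hπ ρ h
  · rw [RTree.at?_append hs]
    exact hσ ρ' ((List.prefix_append_right_inj π).mp hρ)

theorem fnode_cons {t t' : RTree} {i : ℕ} {σ : List ℕ} (ht : t.val = false)
    (hk : t.kids[i]? = some t') (hσ : FNode t' σ) : FNode t (i :: σ) := by
  intro ρ hρ
  rcases List.prefix_cons_iff.mp hρ with rfl | ⟨ρ', rfl, hρ'⟩
  · exact ⟨t, by simp [RTree.at?], ht⟩
  · rw [RTree.at?_cons hk]
    exact hσ ρ' hρ'

theorem InSsat.append {ct cb cd : Bool} {m : ℕ} {t s : RTree} {π σ : List ℕ}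
    (hπ : FNode t π) (hs : t.at? π = some s) (hσ : InSsat ct cb cd m s σ) :
    InSsat ct cb cd m t (π ++ σ) :=
  ⟨hπ.append hs hσ.1, by rw [RTree.seqAt_append hs]; exact hσ.2⟩

theorem inSsat_cons {ct cb cd : Bool} {m : ℕ} {t t' : RTree} {i : ℕ} {σ : List ℕ}
    (ht : t.val = false) (hk : t.kids[i]? = some t') (hσ : InSsat ct cb cd m t' σ) :
    InSsat ct cb cd m t (i :: σ) :=
  ⟨fnode_cons ht hk hσ.1, by
    have h : t.seqAt (i :: σ) = t'.seqAt σ := by simp [RTree.seqAt, RTree.at?_cons hk]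
    rw [h]; exact hσ.2⟩

/-- Every child of a node of a computation tree generates a computation tree. -/
theorem ValidCT.kid {ct cb cd : Bool} {m : ℕ} {hist : List SeqTree} {t s : RTree}
    (h : ValidCT ct cb cd m hist t) (hs : s ∈ t.kids) :
    ∃ hist', ValidCT ct cb cd m hist' s := by
  cases h with
  | db _ _ h => exact ⟨_, h s hs⟩
  | initial | stable | rep => exact absurd hs List.not_mem_nil
  | _ =>
    simp only [RTree.kids, List.mem_cons, List.not_mem_nil, or_false] at hs
    first
      | (subst hs; exact ⟨_, by assumption⟩)
      | (rcases hs with rfl | rfl <;> exact ⟨_, by assumption⟩)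

theorem ValidCT.at? {ct cb cd : Bool} {m : ℕ} {hist : List SeqTree} {t s : RTree} {π : List ℕ}
    (h : ValidCT ct cb cd m hist t) (hs : t.at? π = some s) :
    ∃ hist', ValidCT ct cb cd m hist' s := by
  induction π generalizing t hist with
  | nil =>
    obtain rfl : t = s := by simpa [RTree.at?] using hs
    exact ⟨hist, h⟩
  | cons i π ih =>
    obtain ⟨t', hk, h'⟩ := RTree.exists_kid_of_at?_cons hs
    obtain ⟨hist', ht'⟩ := h.kid (List.mem_of_getElem? hk)
    exact ih ht' h'

/-! ## Invertible steps only enlarge components -/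

/-- Every component of `T` is a component of `T'` with larger antecedent and consequent. -/
def SeqTree.Grow (T T' : SeqTree) : Prop :=
  ∀ w ∈ T.verts, w ∈ T'.verts ∧ T.ant w ⊆ T'.ant w ∧ T.suc w ⊆ T'.suc w

theorem SeqTree.Grow.refl (T : SeqTree) : T.Grow T :=
  fun _ hw => ⟨hw, Finset.Subset.refl _, Finset.Subset.refl _⟩

theorem SeqTree.Grow.trans {T T' T'' : SeqTree} (h : T.Grow T') (h' : T'.Grow T'') :
    T.Grow T'' := by
  intro w hw
  obtain ⟨hw', ha, hs⟩ := h w hw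
  obtain ⟨hw'', ha', hs'⟩ := h' w hw'
  exact ⟨hw'', ha.trans ha', hs.trans hs'⟩

theorem updAt.grow {T T' : SeqTree} {w : ℕ} {s : GSeq} (h : updAt T w s T')
    (ha : T.ant w ⊆ s.1) (hs : T.suc w ⊆ s.2) : T.Grow T' := by
  obtain ⟨⟨hv, -⟩, hl⟩ := h
  intro v hvT
  refine ⟨hv ▸ hvT, ?_⟩
  by_cases hvw : v = w
  · subst hvw
    simpa [SeqTree.ant, SeqTree.suc, hl] using And.intro ha hs
  · simp [SeqTree.ant, SeqTree.suc, hl, hvw]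

theorem addAnt.grow {T T' : SeqTree} {w : ℕ} {A : Fml} (h : addAnt T w A T') : T.Grow T' :=
  h.2.grow (Finset.subset_insert _ _) (Finset.Subset.refl _)

theorem addSuc.grow {T T' : SeqTree} {w : ℕ} {A : Fml} (h : addSuc T w A T') : T.Grow T' :=
  h.2.grow (Finset.Subset.refl _) (Finset.subset_insert _ _)

theorem extendAt.grow {T T' : SeqTree} {w u : ℕ} {x : Bool} {s : GSeq}
    (h : extendAt T w u x s T') : T.Grow T' := by
  obtain ⟨-, hu, hv, -, -, -, hl⟩ := h
  intro v hvT
  have hvu : v ≠ u := fun e => hu (e ▸ hvT)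
  refine ⟨by simp [hv, hvT], ?_⟩
  simp [SeqTree.ant, SeqTree.suc, hl, hvu]

/-! ## Saturated descendants -/

theorem exists_inSsat_grow_of_kid {ct cb cd : Bool} {m : ℕ} {t t' : RTree} {i : ℕ}
    (ht : t.val = false) (hk : t.kids[i]? = some t') (hg : t.seq.Grow t'.seq)
    (h : ∃ σ, InSsat ct cb cd m t' σ ∧ t'.seq.Grow (t'.seqAt σ)) :
    ∃ σ, InSsat ct cb cd m t σ ∧ t.seq.Grow (t.seqAt σ) := by
  obtain ⟨σ, hσ, hg'⟩ := h
  refine ⟨i :: σ, inSsat_cons ht hk hσ, ?_⟩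
  have e : t.seqAt (i :: σ) = t'.seqAt σ := by simp [RTree.seqAt, RTree.at?_cons hk]
  exact e ▸ hg.trans hg'

/-- Below every `F`-labelled node of a computation tree there is a saturated `F`-node that
is reached by invertible steps only. -/
theorem ValidCT.exists_inSsat_grow {ct cb cd : Bool} {m : ℕ} {hist : List SeqTree} {t : RTree}
    (h : ValidCT ct cb cd m hist t) (hv : t.val = false) :
    ∃ σ, InSsat ct cb cd m t σ ∧ t.seq.Grow (t.seqAt σ) := by
  have here : ∀ {t : RTree}, t.val = false → Saturated ct cb cd m t.seq →
      ∃ σ, InSsat ct cb cd m t σ ∧ t.seq.Grow (t.seqAt σ) :=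
    fun ht hS => ⟨[], ⟨fnode_nil ht, hS⟩, SeqTree.Grow.refl _⟩
  induction h with
  | initial => simp [RTree.val] at hv
  | stable _ hS => exact here hv hS.1
  | rep _ hS => exact here hv hS.1
  | db _ hS => exact here hv hS
  | orL _ _ _ _ _ g1 g2 _ _ ih1 ih2 =>
    rcases Bool.and_eq_false_iff.mp hv with h | h
    · exact exists_inSsat_grow_of_kid (i := 0) hv rfl g1.grow (ih1 h)
    · exact exists_inSsat_grow_of_kid (i := 1) hv rfl g2.grow (ih2 h)
  | andR _ _ _ _ _ g1 g2 _ _ ih1 ih2 =>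
    rcases Bool.and_eq_false_iff.mp hv with h | h
    · exact exists_inSsat_grow_of_kid (i := 0) hv rfl g1.grow (ih1 h)
    · exact exists_inSsat_grow_of_kid (i := 1) hv rfl g2.grow (ih2 h)
  | impL _ _ _ _ _ g1 g2 _ _ ih1 ih2 =>
    rcases Bool.and_eq_false_iff.mp hv with h | h
    · exact exists_inSsat_grow_of_kid (i := 0) hv rfl g1.grow (ih1 h)
    · exact exists_inSsat_grow_of_kid (i := 1) hv rfl g2.grow (ih2 h)
  | orR _ _ _ _ g _ ih =>
    refine exists_inSsat_grow_of_kid (i := 0) hv rfl (g.grow (Finset.Subset.refl _) ?_) (ih hv)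
    exact (Finset.subset_insert _ _).trans (Finset.subset_insert _ _)
  | andL _ _ _ _ g _ ih =>
    refine exists_inSsat_grow_of_kid (i := 0) hv rfl (g.grow ?_ (Finset.Subset.refl _)) (ih hv)
    exact (Finset.subset_insert _ _).trans (Finset.subset_insert _ _)
  | diaL _ _ _ _ g _ ih => exact exists_inSsat_grow_of_kid (i := 0) hv rfl g.grow (ih hv)
  | diaR _ _ _ _ _ g _ ih => exact exists_inSsat_grow_of_kid (i := 0) hv rfl g.grow (ih hv)
  | boxL _ _ _ _ _ g _ ih => exact exists_inSsat_grow_of_kid (i := 0) hv rfl g.grow (ih hv)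
  | d _ _ _ _ _ g _ ih => exact exists_inSsat_grow_of_kid (i := 0) hv rfl g.grow (ih hv)

/-- An inner saturated node of a computation tree has a premise of `⊃R` as a child for each
of its output implications. -/
theorem ValidCT.exists_impR_kid {ct cb cd : Bool} {m : ℕ} {hist : List SeqTree} {t : RTree}
    (h : ValidCT ct cb cd m hist t) (hv : t.val = false) (hk : t.kids ≠ [])
    (hS : Saturated ct cb cd m t.seq) {w : ℕ} (hw : w ∈ t.seq.verts) {A B : Fml}
    (hAB : A.imp B ∈ t.seq.suc w) :
    ∃ t' ∈ t.kids, t'.val = false ∧ ImpRRule t.seq w A B t'.seq := by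
  cases h with
  | initial => exact absurd rfl hk
  | stable => exact absurd rfl hk
  | rep => exact absurd rfl hk
  | db _ _ _ _ himp _ =>
    obtain ⟨t', ht', hr⟩ := himp w hw A B hAB
    exact ⟨t', ht', by simpa using List.any_eq_false.mp hv t' ht', hr⟩
  | orL _ hT hm hA hB =>
    obtain ⟨-, -, h, -⟩ := hS _ hT
    exact ((h _ _ hm).elim hA hB).elim
  | orR _ hT hm hA =>
    obtain ⟨-, -, -, h, -⟩ := hS _ hT
    exact (hA (h _ _ hm)).elim
  | andL _ hT hm hA =>
    obtain ⟨-, -, -, -, h, -⟩ := hS _ hT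
    exact (hA (h _ _ hm)).elim
  | andR _ hT hm hA hB =>
    obtain ⟨-, -, -, -, -, h, -⟩ := hS _ hT
    exact ((h _ _ hm).elim hA hB).elim
  | impL _ hT hm hA hB =>
    obtain ⟨-, -, -, -, -, -, h, -⟩ := hS _ hT
    exact ((h _ _ hm).elim hA hB).elim
  | diaL _ hT hm hA =>
    obtain ⟨-, -, -, -, -, -, -, h, -⟩ := hS _ hT
    obtain ⟨u, he, hx, hu⟩ := h _ _ hm
    exact (hA ⟨u, Or.inl ⟨he, hx⟩, hu⟩).elim
  | diaR _ hT hm hr hA =>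
    obtain ⟨-, -, -, -, -, -, -, -, h, -⟩ := hS _ hT
    exact (hA (h _ _ _ hm hr)).elim
  | boxL _ hT hm hr hA =>
    obtain ⟨-, -, -, -, -, -, -, -, -, h, -⟩ := hS _ hT
    exact (hA (h _ _ _ hm hr)).elim
  | d _ hcd hd hle hA hext =>
    obtain ⟨-, -, -, -, -, -, -, -, -, -, h⟩ := hS _ hext.1
    exact (hA (h hcd _ hd hle)).elim

/-- An output implication at an inner saturated node of the blueprint is refuted at a
saturated node below it, in the same component. -/
theorem exists_imp_witness_of_inner {ct cb cd : Bool} {m : ℕ} {hist : List SeqTree}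
    {t s : RTree} {π : List ℕ} (hrun : ValidCT ct cb cd m hist t)
    (hπ : InSsat ct cb cd m t π) (hs : t.at? π = some s) (hk : s.kids ≠ [])
    {w : ℕ} (hw : w ∈ (t.seqAt π).verts) {A B : Fml} (hAB : A.imp B ∈ (t.seqAt π).suc w) :
    ∃ π', π <+: π' ∧ InSsat ct cb cd m t π' ∧ w ∈ (t.seqAt π').verts ∧
      A ∈ (t.seqAt π').ant w ∧ B ∈ (t.seqAt π').suc w := by
  obtain ⟨hist', hval⟩ := hrun.at? hs
  obtain ⟨s', hs', hsv⟩ := hπ.1.exists_at?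
  obtain rfl : s = s' := Option.some.inj (hs.symm.trans hs')
  have hsat := hπ.2
  rw [RTree.seqAt_of_at? hs] at hw hAB hsat
  obtain ⟨t', ht', hv', -, -, hshape, -, hl⟩ := hval.exists_impR_kid hsv hk hsat hw hAB
  obtain ⟨i, hi⟩ := List.getElem?_of_mem ht'
  obtain ⟨hist'', hval'⟩ := hval.kid ht'
  obtain ⟨σ, hσ, hg⟩ := hval'.exists_inSsat_grow hv'
  have e : t.seqAt (π ++ i :: σ) = t'.seqAt σ := by
    rw [RTree.seqAt_append hs]
    simp [RTree.seqAt, RTree.at?_cons hi]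
  obtain ⟨hw', ha, hb⟩ := hg w (hshape.1 ▸ hw)
  refine ⟨π ++ i :: σ, List.prefix_append _ _, InSsat.append hπ.1 hs (inSsat_cons hsv hi hσ), ?_⟩
  rw [e]
  exact ⟨hw', ha (by simp [SeqTree.ant, hl]), hb (by simp [SeqTree.suc, hl])⟩

theorem RTree.kids_ne_nil_of_proper_prefix {t s s' : RTree} {π π' : List ℕ} (hp : π <+: π')
    (hne : π ≠ π') (hs : t.at? π = some s) (hs' : t.at? π' = some s') : s.kids ≠ [] := by
  obtain ⟨σ, rfl⟩ := hp
  rw [RTree.at?_append hs] at hs'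
  cases σ with
  | nil => simp at hne
  | cons i σ =>
    obtain ⟨t', hk, -⟩ := RTree.exists_kid_of_at?_cons hs'
    exact List.ne_nil_of_mem (List.mem_of_getElem? hk)

/-- Lemma 4.9(2): in the blueprint of a failed run of
`Prove_C`, if `A ⊃ B` belongs to the consequent of the component `(w,π)` of a
saturated seq-tree, then there is a saturated seq-tree of the blueprint with a
component `(u,π')` such that `(w,π) ⟶_σ (u,π')`, `A` belongs to the antecedent
of `(u,π')`, and `B` belongs to the consequent of `(u,π')`. -/
theorem blueprint_imp_witness (ct cb cd : Bool) (I : SeqTree) (t : RTree)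
    (hrun : ValidCT ct cb cd I.mdep [] t) (hseq : t.seq = I) (hval : t.val = false)
    (gc : List ℕ → List ℕ) (gf : List ℕ → ℕ → ℕ)
    (hγ : GammaOK ct cb cd I.mdep t gc gf)
    (π : List ℕ) (w : ℕ) (A B : Fml)
    (hπ : InSsat ct cb cd I.mdep t π) (hw : w ∈ (t.seqAt π).verts)
    (hAB : Fml.imp A B ∈ (t.seqAt π).suc w) :
    ∃ (π' : List ℕ) (u : ℕ), InSsat ct cb cd I.mdep t π' ∧
      u ∈ (t.seqAt π').verts ∧
      MSeq ct cb cd I.mdep t gc gf (w, π) (u, π') ∧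
      A ∈ (t.seqAt π').ant u ∧ B ∈ (t.seqAt π').suc u := by
  obtain ⟨s, hs, -⟩ := hπ.1.exists_at?
  by_cases hk : s.kids = []
  · have hrep : RepNode ct cb cd I.mdep t π :=
      ⟨hπ.1, ⟨s, hs, hk⟩, hπ.2, fun hst => (hst.2 w hw).1 A B hAB⟩
    obtain ⟨hp, hne, hc, hm⟩ := hγ π hrep
    obtain ⟨c, hcs, -⟩ := hc.1.exists_at?
    have hw' := hm.1.1 w hw
    have hAB' : A.imp B ∈ (t.seqAt (gc π)).suc (gf π w) := by
      simpa [SeqTree.suc, hm.2 w hw] using hAB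
    obtain ⟨π', hpre, hπ', hu, hA, hB⟩ := exists_imp_witness_of_inner hrun hc hcs
      (RTree.kids_ne_nil_of_proper_prefix hp hne hcs hs) hw' hAB'
    exact ⟨π', gf π w, hπ', hu,
      .tail (.single (.rep hrep hw)) (.nat hc hπ' hpre hw'), hA, hB⟩
  · obtain ⟨π', hpre, hπ', hu, hA, hB⟩ := exists_imp_witness_of_inner hrun hπ hs hk hw hAB
    exact ⟨π', w, hπ', hu, .single (.nat hπ hπ' hpre hw), hA, hB⟩
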